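/- Let ψ_k(ν) = P_ν(λ_k) be as in the discrete Sturm–Liouville problem, let m ∈ {1,…,q+1}, and let f : [0,q]_Z → ℝ be a nontrivial function of the form f(ν) = Σ_{k=m}^{q+1} a_k ψ_k(ν) with real coefficients (a spectral gap of length m). Then m − 1 ≤ S^−(f) ≤ N(f). -/

import Mathlib

namespace DiscPaper

/-- `ν` is a zero (of the first or second type) of the discrete function `f` on `[0,q]_ℤ`. -/
def IsZero (q : ℕ) (f : ℕ → ℝ) (ν : ℕ) : Prop :=
  (ν ≤ q ∧ f ν = 0) ∨ (1 ≤ ν ∧ ν ≤ q ∧ f (ν - 1) * f ν < 0)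

/-- `N q f` is the number of zeros (of both types) of `f` on `[0,q]_ℤ`. -/
noncomputable def N (q : ℕ) (f : ℕ → ℝ) : ℕ := {ν : ℕ | IsZero q f ν}.ncard

/-- `N₀ q f` is the number of zeros of the first type of `f` on `[0,q]_ℤ`. -/
noncomputable def N0 (q : ℕ) (f : ℕ → ℝ) : ℕ := {ν : ℕ | ν ≤ q ∧ f ν = 0}.ncard

/-- Number of sign changes of `g` on `[0,q]_ℤ`. -/
noncomputable def signChanges (q : ℕ) (g : ℕ → ℝ) : ℕ :=
  {ν : ℕ | 1 ≤ ν ∧ ν ≤ q ∧ g (ν - 1) * g ν < 0}.ncard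

/-- `g` is obtained from `f` by replacing all its zero values on `[0,q]_ℤ` by
arbitrary nonzero values. -/
def Admissible (q : ℕ) (f g : ℕ → ℝ) : Prop :=
  (∀ ν ≤ q, g ν ≠ 0) ∧ ∀ ν ≤ q, f ν ≠ 0 → g ν = f ν

/-- `S⁻(f)`: least number of sign changes over all admissible replacements. -/
noncomputable def Sminus (q : ℕ) (f : ℕ → ℝ) : ℕ :=
  sInf {s | ∃ g, Admissible q f g ∧ signChanges q g = s}

/-- `S⁺(f)`: largest number of sign changes over all admissible replacements. -/
noncomputable def Splus (q : ℕ) (f : ℕ → ℝ) : ℕ :=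
  sSup {s | ∃ g, Admissible q f g ∧ signChanges q g = s}
open Polynomial in
/-- STATEMENT SETUP: the polynomials `P_l` generated by the three-term recurrence
`γ_{l-1} P_{l-1} + α_l P_l + β_l P_{l+1} = λ ρ_l P_l` with `P_{-1} = 0`, `P_0 = 1`. -/
structure Recurrence (α β γ ρ : ℕ → ℝ) (P : ℕ → Polynomial ℝ) : Prop where
  hβ : ∀ l, 0 < β l
  hγ : ∀ l, 0 < γ l
  hρ : ∀ l, 0 < ρ l
  hP0 : P 0 = 1
  hrec0 : C (α 0) * P 0 + C (β 0) * P 1 = X * (C (ρ 0) * P 0)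
  hrec : ∀ l : ℕ,
    C (γ l) * P l + C (α (l + 1)) * P (l + 1) + C (β (l + 1)) * P (l + 2) =
      X * (C (ρ (l + 1)) * P (l + 1))

/-- STATEMENT SETUP: `Λ (k-1)` is the `k`-th zero `λ_k` of
`P̃_{q+1} = P_{q+1} - η P_q`, ordered decreasingly: `λ_{q+1} < ⋯ < λ_1`. -/
structure SLZeros (P : ℕ → Polynomial ℝ) (q : ℕ) (η : ℝ) (Λ : ℕ → ℝ) : Prop where
  anti : StrictAntiOn Λ (Set.Iic q)
  root : ∀ i ≤ q, (P (q + 1) - Polynomial.C η * P q).eval (Λ i) = 0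


/-- `f` has `s` strict sign alternations on `[0,q]`. -/
def Alt (q : ℕ) (f : ℕ → ℝ) (s : ℕ) : Prop :=
  ∃ (σ : ℝ) (v : ℕ → ℕ), (∀ i < s, v i < v (i + 1)) ∧
    ∀ i ≤ s, v i ≤ q ∧ 0 < σ * (-1) ^ i * f (v i)

lemma exists_signChange (g : ℕ → ℝ) (a d : ℕ) (hne : ∀ ν ≤ a + d, g ν ≠ 0)
    (h : g a * g (a + d) < 0) : ∃ ν, a < ν ∧ ν ≤ a + d ∧ g (ν - 1) * g ν < 0 := by
  induction d with
  | zero => exact absurd h (not_lt.mpr (mul_self_nonneg _))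
  | succ d ih =>
    by_cases h1 : g (a + d) * g (a + (d + 1)) < 0
    · exact ⟨a + d + 1, by omega, by omega, h1⟩
    · have h0 := hne (a + d) (by omega)
      have h2 := hne (a + (d + 1)) (by omega)
      have h1' : 0 < g (a + d) * g (a + (d + 1)) :=
        lt_of_le_of_ne (not_lt.mp h1) (mul_ne_zero h0 h2).symm
      have : g a * g (a + d) < 0 := by
        by_contra hc
        push Not at hc
        have h3 : 0 ≤ (g a * g (a + d)) * (g (a + d) * g (a + (d + 1))) :=
          mul_nonneg hc h1'.le
        have h4 : 0 < g (a + d) ^ 2 := by positivity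
        nlinarith
      obtain ⟨ν, h5, h6, h7⟩ := ih (fun ν hν => hne ν (by omega)) this
      exact ⟨ν, h5, by omega, h7⟩

lemma finite_sc (q : ℕ) (g : ℕ → ℝ) :
    {ν : ℕ | 1 ≤ ν ∧ ν ≤ q ∧ g (ν - 1) * g ν < 0}.Finite :=
  (Set.finite_Iic q).subset fun _ h => h.2.1

lemma alt_le_signChanges {q : ℕ} {f g : ℕ → ℝ} {s : ℕ} (hA : Alt q f s)
    (hg : Admissible q f g) : s ≤ signChanges q g := by
  obtain ⟨σ, v, hv, hs⟩ := hA
  have hgv : ∀ i ≤ s, g (v i) = f (v i) := fun i hi =>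
    hg.2 _ (hs i hi).1 (fun h0 => by have := (hs i hi).2; rw [h0] at this; simp at this)
  have key : ∀ i : ℕ, ∃ ν, i < s → v i < ν ∧ ν ≤ v (i + 1) ∧ g (ν - 1) * g ν < 0 := by
    intro i
    by_cases hi : i < s
    · have h1 := hs i hi.le
      have h2 := hs (i + 1) hi
      have hlt := hv i hi
      obtain ⟨d, hd⟩ := Nat.exists_eq_add_of_le hlt.le
      have h3 : g (v i) * g (v i + d) < 0 := by
        rw [← hd, hgv i hi.le, hgv (i + 1) hi]
        have hp := mul_pos h1.2 h2.2
        have e : σ * (-1) ^ i * f (v i) * (σ * (-1) ^ (i + 1) * f (v (i + 1))) =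
          -((σ * (-1) ^ i) ^ 2 * (f (v i) * f (v (i + 1)))) := by ring
        rw [e] at hp
        by_contra hc
        push Not at hc
        have := mul_nonneg (sq_nonneg (σ * (-1) ^ i)) hc
        linarith
      obtain ⟨ν, h4, h5, h6⟩ := exists_signChange g (v i) d
        (fun ν hν => hg.1 ν (by have := h2.1; omega)) h3
      exact ⟨ν, fun _ => ⟨h4, by omega, h6⟩⟩
    · exact ⟨0, fun h => absurd h hi⟩
  choose n hn using key
  have vmono : ∀ i j, i ≤ j → j ≤ s → v i ≤ v j := by
    intro i j hij
    induction j, hij using Nat.le_induction with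
    | base => intro _; exact le_rfl
    | succ j _ ih => intro hj; exact (ih (by omega)).trans (hv j (by omega)).le
  have nmono : ∀ i j, i < j → j < s → n i < n j := by
    intro i j hij hj
    have h1 := (hn i (by omega)).2.1
    have h2 := (hn j hj).1
    have h3 := vmono (i + 1) j hij hj.le
    omega
  have hinj : Set.InjOn n (↑(Finset.range s)) := by
    intro i hi j hj hij
    simp at hi hj
    rcases lt_trichotomy i j with h | h | h
    · have := nmono i j h hj; omega
    · exact h
    · have := nmono j i h hi; omega
  unfold signChanges
  have hsub : (↑((Finset.range s).image n) : Set ℕ) ⊆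
      {ν : ℕ | 1 ≤ ν ∧ ν ≤ q ∧ g (ν - 1) * g ν < 0} := by
    intro x hx
    simp only [Finset.coe_image, Set.mem_image, Finset.coe_range, Set.mem_Iio] at hx
    obtain ⟨i, hi, rfl⟩ := hx
    have h1 := hn i hi
    have h2 := (hs (i + 1) hi).1
    exact ⟨by omega, by omega, h1.2.2⟩
  have := Set.ncard_le_ncard hsub (finite_sc q g)
  rwa [Set.ncard_coe_finset, Finset.card_image_of_injOn hinj, Finset.card_range] at this

/-- Fill zeros by the next value. -/
noncomputable def fillAux (q : ℕ) (f : ℕ → ℝ) : ℕ → ℝ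
  | 0 => if f q = 0 then 1 else f q
  | j + 1 => if f (q - (j + 1)) = 0 then fillAux q f j else f (q - (j + 1))

lemma fillAux_ne (q : ℕ) (f : ℕ → ℝ) (j : ℕ) : fillAux q f j ≠ 0 := by
  induction j with
  | zero => unfold fillAux; split_ifs with h <;> simp [h]
  | succ j ih => unfold fillAux; split_ifs with h <;> simp [h, ih]

lemma fillAux_eq (q : ℕ) (f : ℕ → ℝ) (j : ℕ) (h : f (q - j) ≠ 0) :
    fillAux q f j = f (q - j) := by
  cases j with
  | zero => simp at h; simp [fillAux, h]
  | succ j => simp [fillAux, h]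

lemma fill_admissible (q : ℕ) (f : ℕ → ℝ) :
    Admissible q f (fun ν => fillAux q f (q - ν)) := by
  refine ⟨fun ν _ => fillAux_ne _ _ _, fun ν hν h => ?_⟩
  have e : q - (q - ν) = ν := by omega
  have := fillAux_eq q f (q - ν) (by rwa [e])
  simpa [e] using this

lemma fill_le (q : ℕ) (f : ℕ → ℝ) :
    signChanges q (fun ν => fillAux q f (q - ν)) ≤ N q f := by
  unfold signChanges N
  apply Set.ncard_le_ncard
  · rintro ν ⟨h1, h2, h3⟩
    by_cases h0 : f ν = 0
    · exact Or.inl ⟨h2, h0⟩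
    have e : q - (q - ν) = ν := by omega
    have e1 : q - (q - (ν - 1)) = ν - 1 := by omega
    by_cases hp : f (ν - 1) = 0
    · exfalso
      have e2 : q - (ν - 1) = (q - ν) + 1 := by omega
      have e3 : q - (q - ν + 1) = ν - 1 := by omega
      have : fillAux q f (q - (ν - 1)) = fillAux q f (q - ν) := by
        rw [e2, fillAux, e3, if_pos hp]
      simp only [this] at h3
      exact absurd h3 (not_lt.mpr (mul_self_nonneg _))
    · right
      refine ⟨h1, h2, ?_⟩
      simp only at h3
      rwa [fillAux_eq q f (q - ν) (by rwa [e]), fillAux_eq q f (q - (ν - 1)) (by rwa [e1]),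
        e, e1] at h3
  · apply (Set.finite_Iic q).subset
    rintro ν (h | h)
    · exact h.1
    · exact h.2.1

lemma Sminus_le_N (q : ℕ) (f : ℕ → ℝ) : Sminus q f ≤ N q f :=
  le_trans (Nat.sInf_le (⟨_, fill_admissible q f, rfl⟩ :
    signChanges q (fun ν => fillAux q f (q - ν)) ∈
      {s | ∃ g, Admissible q f g ∧ signChanges q g = s})) (fill_le q f)

lemma Alt.le_Sminus {q : ℕ} {f : ℕ → ℝ} {s : ℕ} (h : Alt q f s) : s ≤ Sminus q f := by
  unfold Sminus
  apply le_csInf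
  · exact ⟨_, _, fill_admissible q f, rfl⟩
  · rintro b ⟨g, hg, rfl⟩
    exact alt_le_signChanges h hg

lemma Alt.mono {q : ℕ} {f : ℕ → ℝ} {s t : ℕ} (h : Alt q f s) (hts : t ≤ s) : Alt q f t := by
  obtain ⟨σ, v, h1, h2⟩ := h
  exact ⟨σ, v, fun i hi => h1 i (by omega), fun i hi => h2 i (by omega)⟩

lemma exists_runmax (q : ℕ) (h : ℕ → ℝ) (v : ℕ) (hv : v ≤ q) (hp : 0 < h v) :
    ∃ w ≤ q, 0 < h w ∧ (∀ μ, (w ≤ μ ∧ μ ≤ v) ∨ (v ≤ μ ∧ μ ≤ w) → 0 < h μ) ∧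
      ∀ u ≤ q, u ≤ w + 1 → w ≤ u + 1 → h u ≤ h w := by
  classical
  let R := (Finset.range (q + 1)).filter
    (fun w => ∀ μ, (w ≤ μ ∧ μ ≤ v) ∨ (v ≤ μ ∧ μ ≤ w) → 0 < h μ)
  have hR : R.Nonempty := ⟨v, by
    simp only [R, Finset.mem_filter, Finset.mem_range]
    refine ⟨by omega, fun μ hμ => ?_⟩
    have : μ = v := by omega
    rwa [this]⟩
  obtain ⟨w, hw, hmax⟩ := R.exists_max_image h hR
  simp only [R, Finset.mem_filter, Finset.mem_range] at hw hmax
  have hw0 : 0 < h w := hw.2 w (by omega)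
  refine ⟨w, by omega, hw0, hw.2, fun u hu h1 h2 => ?_⟩
  by_cases hu0 : 0 < h u
  · apply hmax u
    refine ⟨by omega, fun μ hμ => ?_⟩
    by_cases e : μ = u
    · rwa [e]
    · exact hw.2 μ (by omega)
  · linarith

lemma Alt.maxprinc {q : ℕ} {f F : ℕ → ℝ} {s : ℕ} (h : Alt q f s)
    (H : ∀ (σ : ℝ) (w : ℕ), w ≤ q → 0 < σ * f w →
      (∀ u ≤ q, u ≤ w + 1 → w ≤ u + 1 → σ * f u ≤ σ * f w) → 0 < σ * F w) :
    Alt q F s := by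
  obtain ⟨σ, v, h1, h2⟩ := h
  have key : ∀ i : ℕ, ∃ w, i ≤ s → w ≤ q ∧ 0 < σ * (-1) ^ i * f w ∧
      (∀ μ, (w ≤ μ ∧ μ ≤ v i) ∨ (v i ≤ μ ∧ μ ≤ w) → 0 < σ * (-1) ^ i * f μ) ∧
      ∀ u ≤ q, u ≤ w + 1 → w ≤ u + 1 → σ * (-1) ^ i * f u ≤ σ * (-1) ^ i * f w := by
    intro i
    by_cases hi : i ≤ s
    · obtain ⟨w, a, b, c, d⟩ := exists_runmax q (fun x => σ * (-1) ^ i * f x) (v i)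
        (h2 i hi).1 (h2 i hi).2
      exact ⟨w, fun _ => ⟨a, b, c, d⟩⟩
    · exact ⟨0, fun h => absurd h hi⟩
  choose w hw using key
  refine ⟨σ, w, fun i hi => ?_, fun i hi => ⟨(hw i hi).1, H _ _ (hw i hi).1 (hw i hi).2.1
    (hw i hi).2.2.2⟩⟩
  obtain ⟨-, a1, a2, -⟩ := hw i hi.le
  obtain ⟨-, b1, b2, -⟩ := hw (i + 1) hi
  have hv := h1 i hi
  by_contra hc
  by_cases hc1 : v (i + 1) ≤ w i
  · have x := a2 (v (i + 1)) (by omega)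
    have y := (h2 (i + 1) hi).2
    rw [pow_succ] at y
    linarith
  · have x := b2 (w i) (by omega)
    rw [pow_succ] at x
    linarith

lemma Alt.of_weak {q : ℕ} {f ψ : ℕ → ℝ} {s : ℕ} (h : Alt q f s) {b : ℝ} (hb : b ≠ 0)
    (hs : ∀ ν ≤ q, ψ ν ≠ 0 → 0 < b * ψ ν * f ν)
    (h0 : ψ 0 ≠ 0) (hz : ∀ ν, ν + 1 ≤ q → ψ (ν + 1) = 0 → ν + 2 ≤ q ∧ ψ ν * ψ (ν + 2) < 0) :
    Alt q ψ s := by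
  obtain ⟨σ, v, h1, h2⟩ := h
  have key : ∀ i : ℕ, ∃ w, i ≤ s → w ≤ q ∧ 0 < σ * b * (-1) ^ i * ψ w ∧
      (w = v i ∨ (ψ (v i) = 0 ∧ (w = v i + 1 ∨ w + 1 = v i))) := by
    intro i
    by_cases hi : i ≤ s
    · obtain ⟨hq, hp⟩ := h2 i hi
      by_cases hψ : ψ (v i) = 0
      · obtain ⟨ν, hν⟩ : ∃ ν, v i = ν + 1 := Nat.exists_eq_succ_of_ne_zero (fun e => h0 (e ▸ hψ))
        obtain ⟨hq2, hneg⟩ := hz ν (by omega) (hν ▸ hψ)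
        have hc : σ * b * (-1) ^ i ≠ 0 := by
          refine mul_ne_zero (mul_ne_zero (fun e => by simp [e] at hp) hb) (by simp)
        generalize σ * b * (-1) ^ i = t at hc
        by_cases ht : 0 < t * ψ ν
        · exact ⟨ν, fun _ => ⟨by omega, ht, Or.inr ⟨hψ, Or.inr hν.symm⟩⟩⟩
        · refine ⟨ν + 2, fun _ => ⟨hq2, ?_, Or.inr ⟨hψ, Or.inl (by omega)⟩⟩⟩
          by_contra hcc
          push Not at ht hcc
          have := mul_nonneg_of_nonpos_of_nonpos ht hcc
          have h3 : 0 < t ^ 2 := by positivity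
          nlinarith
      · refine ⟨v i, fun _ => ⟨hq, ?_, Or.inl rfl⟩⟩
        have h3 := mul_pos (hs _ hq hψ) hp
        have h4 : f (v i) ≠ 0 := fun e => by simp [e] at hp
        have h5 : 0 < f (v i) ^ 2 := by positivity
        by_contra hcc
        push Not at hcc
        nlinarith
    · exact ⟨0, fun h => absurd h hi⟩
  choose w hw using key
  refine ⟨σ * b, w, fun i hi => ?_, fun i hi => ⟨(hw i hi).1, (hw i hi).2.1⟩⟩
  obtain ⟨-, a1, a2⟩ := hw i hi.le
  obtain ⟨-, b1, b2⟩ := hw (i + 1) hi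
  have hv := h1 i hi
  have hne : w i ≠ w (i + 1) := by
    intro e
    rw [← e, pow_succ] at b1
    linarith
  have hadj : v (i + 1) = v i + 1 → ψ (v i) = 0 → ψ (v (i + 1)) = 0 → False := by
    intro e e1 e2
    obtain ⟨ν, hν⟩ : ∃ ν, v i = ν + 1 := Nat.exists_eq_succ_of_ne_zero (fun e => h0 (e ▸ e1))
    have := (hz ν (by have := (h2 i hi.le).1; omega) (hν ▸ e1)).2
    rw [e, hν] at e2
    simp [e2] at this
  rcases a2 with a2 | ⟨a3, a2⟩ <;> rcases b2 with b2 | ⟨b3, b2⟩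
  · omega
  · omega
  · omega
  · have : v (i + 1) ≠ v i + 1 := fun e => hadj e a3 b3
    omega

lemma Alt.of_strict {q : ℕ} {f ψ : ℕ → ℝ} {s : ℕ} (h : Alt q ψ s) {b : ℝ}
    (hs : ∀ ν ≤ q, ψ ν ≠ 0 → 0 < b * ψ ν * f ν) : Alt q f s := by
  obtain ⟨σ, v, h1, h2⟩ := h
  refine ⟨σ * b, v, h1, fun i hi => ⟨(h2 i hi).1, ?_⟩⟩
  obtain ⟨hq, hp⟩ := h2 i hi
  have h4 : ψ (v i) ≠ 0 := fun e => by simp [e] at hp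
  have h3 := mul_pos (hs _ hq h4) hp
  have h5 : 0 < ψ (v i) ^ 2 := by positivity
  by_contra hcc
  push Not at hcc
  nlinarith

/-- linear combination of eigenfunctions -/
noncomputable def E (P : ℕ → Polynomial ℝ) (q : ℕ) (Λ b : ℕ → ℝ) (ν : ℕ) : ℝ :=
  ∑ i ∈ Finset.range (q + 1), b i * (P ν).eval (Λ i)

section
variable {α β γ ρ : ℕ → ℝ} {P : ℕ → Polynomial ℝ}

lemma ev0 (hP : Recurrence α β γ ρ P) (x : ℝ) :
    α 0 * (P 0).eval x + β 0 * (P 1).eval x = x * (ρ 0 * (P 0).eval x) := by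
  simpa using congrArg (Polynomial.eval x) hP.hrec0

lemma ev1 (hP : Recurrence α β γ ρ P) (x : ℝ) (l : ℕ) :
    γ l * (P l).eval x + α (l + 1) * (P (l + 1)).eval x + β (l + 1) * (P (l + 2)).eval x
      = x * (ρ (l + 1) * (P (l + 1)).eval x) := by
  simpa using congrArg (Polynomial.eval x) (hP.hrec l)

lemma no_adj (hP : Recurrence α β γ ρ P) (x : ℝ) (l : ℕ) (h : (P l).eval x = 0) :
    (P (l + 1)).eval x ≠ 0 := by
  induction l with
  | zero => simp [hP.hP0] at h
  | succ l ih =>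
    intro h2
    have := ev1 hP x l
    rw [h, h2] at this
    have h3 : (P l).eval x = 0 := by
      have := (hP.hγ l).ne'
      simp_all
    exact ih h3 h

lemma psi_zero (hP : Recurrence α β γ ρ P) {q : ℕ} {η x : ℝ}
    (hx : (P (q + 1)).eval x = η * (P q).eval x) (ν : ℕ) (hν : ν + 1 ≤ q)
    (h : (P (ν + 1)).eval x = 0) :
    ν + 2 ≤ q ∧ (P ν).eval x * (P (ν + 2)).eval x < 0 := by
  have h1 : (P ν).eval x ≠ 0 := fun e => no_adj hP x ν e h
  constructor
  · by_contra hc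
    have : q = ν + 1 := by omega
    subst this
    exact no_adj hP x _ h (by rw [hx, h, mul_zero])
  · have e := ev1 hP x ν
    rw [h] at e
    have hb := hP.hβ (ν + 1)
    have hg := hP.hγ ν
    have h2 : 0 < (P ν).eval x ^ 2 := by positivity
    by_contra hc
    push Not at hc
    have := mul_nonneg hb.le hc
    have h3 := mul_pos hg h2
    have : (P ν).eval x * (γ ν * (P ν).eval x + α (ν + 1) * 0 +
      β (ν + 1) * (P (ν + 2)).eval x) = 0 := by rw [e]; ring
    nlinarith

lemma E_rec0 (hP : Recurrence α β γ ρ P) (q : ℕ) (Λ b : ℕ → ℝ) (c : ℝ) :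
    ρ 0 * E P q Λ (fun i => (c - Λ i) * b i) 0 =
      (c * ρ 0 - α 0) * E P q Λ b 0 - β 0 * E P q Λ b 1 := by
  simp only [E, Finset.mul_sum, ← Finset.sum_sub_distrib]
  refine Finset.sum_congr rfl fun i _ => ?_
  linear_combination (b i) * ev0 hP (Λ i)

lemma E_rec1 (hP : Recurrence α β γ ρ P) (q : ℕ) (Λ b : ℕ → ℝ) (c : ℝ) (l : ℕ) :
    ρ (l + 1) * E P q Λ (fun i => (c - Λ i) * b i) (l + 1) =
      (c * ρ (l + 1) - α (l + 1)) * E P q Λ b (l + 1) - γ l * E P q Λ b l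
        - β (l + 1) * E P q Λ b (l + 2) := by
  simp only [E, Finset.mul_sum, ← Finset.sum_sub_distrib]
  refine Finset.sum_congr rfl fun i _ => ?_
  linear_combination (b i) * ev1 hP (Λ i) l

lemma root_eq {q : ℕ} {η : ℝ} {Λ : ℕ → ℝ} (hΛ : SLZeros P q η Λ) (i : ℕ) (hi : i ≤ q) :
    (P (q + 1)).eval (Λ i) = η * (P q).eval (Λ i) := by
  have := hΛ.root i hi
  simp at this
  linarith

lemma E_bd {q : ℕ} {η : ℝ} {Λ : ℕ → ℝ} (hΛ : SLZeros P q η Λ) (b : ℕ → ℝ) :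
    E P q Λ b (q + 1) = η * E P q Λ b q := by
  simp only [E, Finset.mul_sum]
  refine Finset.sum_congr rfl fun i hi => ?_
  rw [root_eq hΛ i (by simp at hi; omega)]
  ring

lemma alt_step (hP : Recurrence α β γ ρ P) {q : ℕ} {η : ℝ} {Λ : ℕ → ℝ}
    (hΛ : SLZeros P q η Λ) {c : ℝ}
    (hc : ∀ w ≤ q, |α w| + γ (w - 1) + β w * (1 + |η|) < c * ρ w)
    {b : ℕ → ℝ} {s : ℕ} (h : Alt q (E P q Λ b) s) :
    Alt q (E P q Λ (fun i => (c - Λ i) * b i)) s := by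
  refine h.maxprinc fun σ w hw hpos hmax => ?_
  have hβ := hP.hβ w
  have hρ := hP.hρ w
  have hcw := hc w hw
  -- bound for the right neighbour
  have hr : β w * (σ * E P q Λ b (w + 1)) ≤ β w * (1 + |η|) * (σ * E P q Λ b w) := by
    rw [mul_assoc]
    apply mul_le_mul_of_nonneg_left _ hβ.le
    rcases hw.lt_or_eq with h | h
    · have h1 := hmax (w + 1) h le_rfl (by omega)
      have h2 := mul_nonneg (abs_nonneg η) hpos.le
      nlinarith
    · subst h
      rw [E_bd hΛ]
      have h2 := mul_le_mul_of_nonneg_right (le_abs_self η) hpos.le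
      nlinarith
  have ha := mul_le_mul_of_nonneg_right (le_abs_self (α w)) hpos.le
  have hm := mul_lt_mul_of_pos_right hcw hpos
  have hfin : 0 < ρ w * (σ * E P q Λ (fun i => (c - Λ i) * b i) w) := by
    cases w with
    | zero =>
      have e := E_rec0 hP q Λ b c
      have hg := mul_pos (hP.hγ 0) hpos
      have e2 : ρ 0 * (σ * E P q Λ (fun i => (c - Λ i) * b i) 0) =
        (c * ρ 0 - α 0) * (σ * E P q Λ b 0) - β 0 * (σ * E P q Λ b 1) := by
        linear_combination σ * e
      rw [e2]
      simp only [Nat.zero_sub, zero_add] at hm hr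
      nlinarith
    | succ l =>
      have e := E_rec1 hP q Λ b c l
      have hl := mul_le_mul_of_nonneg_left (hmax l (by omega) (by omega) (by omega)) (hP.hγ l).le
      have e2 : ρ (l + 1) * (σ * E P q Λ (fun i => (c - Λ i) * b i) (l + 1)) =
        (c * ρ (l + 1) - α (l + 1)) * (σ * E P q Λ b (l + 1)) - γ l * (σ * E P q Λ b l)
         - β (l + 1) * (σ * E P q Λ b (l + 2)) := by
        linear_combination σ * e
      rw [e2]
      simp only [Nat.add_sub_cancel] at hm
      rw [show l + 1 + 1 = l + 2 from rfl] at hr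
      nlinarith
  exact pos_of_mul_pos_right hfin hρ.le

lemma alt_iter (hP : Recurrence α β γ ρ P) {q : ℕ} {η : ℝ} {Λ : ℕ → ℝ}
    (hΛ : SLZeros P q η Λ) {c : ℝ}
    (hc : ∀ w ≤ q, |α w| + γ (w - 1) + β w * (1 + |η|) < c * ρ w)
    {b : ℕ → ℝ} {s : ℕ} (h : Alt q (E P q Λ b) s) (n : ℕ) :
    Alt q (E P q Λ (fun i => (c - Λ i) ^ n * b i)) s := by
  induction n with
  | zero => simpa using h
  | succ n ih =>
    have := alt_step hP hΛ hc ih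
    convert this using 3 with i
    ring

lemma exists_c (hP : Recurrence α β γ ρ P) (q : ℕ) (η : ℝ) (Λ : ℕ → ℝ) :
    ∃ c : ℝ, (∀ w ≤ q, |α w| + γ (w - 1) + β w * (1 + |η|) < c * ρ w) ∧
      ∀ i ≤ q, Λ i < c := by
  let g : ℕ → ℝ := fun w => (|α w| + γ (w - 1) + β w * (1 + |η|)) / ρ w
  refine ⟨1 + ∑ w ∈ Finset.range (q + 1), (|g w| + |Λ w|), fun w hw => ?_, fun w hw => ?_⟩
  · have h := Finset.single_le_sum (f := fun w => |g w| + |Λ w|) (s := Finset.range (q + 1))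
      (fun i _ => by positivity) (Finset.mem_range.mpr (by omega : w < q + 1))
    rw [← div_lt_iff₀ (hP.hρ w)]
    have h1 := le_abs_self (g w)
    have h2 := abs_nonneg (Λ w)
    change g w < _
    linarith
  · have h := Finset.single_le_sum (f := fun w => |g w| + |Λ w|) (s := Finset.range (q + 1))
      (fun i _ => by positivity) (Finset.mem_range.mpr (by omega : w < q + 1))
    have h1 := le_abs_self (Λ w)
    have h2 := abs_nonneg (g w)
    linarith

open Filter Topology in
lemma sign_lim (q : ℕ) (Λ b d : ℕ → ℝ) (j : ℕ) (hj : j ≤ q) (hb : b j ≠ 0)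
    (hd : ∀ i ≤ q, 0 < d i) (hlt : ∀ i ≤ q, i ≠ j → b i ≠ 0 → d i < d j) :
    ∃ n : ℕ, ∀ ν ≤ q, (P ν).eval (Λ j) ≠ 0 →
      0 < b j * (P ν).eval (Λ j) * E P q Λ (fun i => d i ^ n * b i) ν := by
  have hdj := hd j hj
  have hlim : ∀ ν, Tendsto (fun n : ℕ => b j * (P ν).eval (Λ j) *
      ∑ i ∈ Finset.range (q + 1), (d i / d j) ^ n * (b i * (P ν).eval (Λ i))) atTop
      (𝓝 (b j * (P ν).eval (Λ j) * ∑ i ∈ Finset.range (q + 1),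
        if i = j then b i * (P ν).eval (Λ i) else 0)) := by
    intro ν
    refine Tendsto.const_mul _ (tendsto_finsetSum _ fun i hi => ?_)
    have hi' : i ≤ q := by simp at hi; omega
    by_cases e : i = j
    · subst e
      simp [div_self hdj.ne']
    · rw [if_neg e]
      by_cases e2 : b i = 0
      · simp [e2]
      · have := tendsto_pow_atTop_nhds_zero_of_lt_one (div_pos (hd i hi') hdj).le
          ((div_lt_one hdj).mpr (hlt i hi' e e2))
        simpa using this.mul_const (b i * (P ν).eval (Λ i))
  have hev : ∀ᶠ n : ℕ in atTop, ∀ ν ∈ Finset.range (q + 1), (P ν).eval (Λ j) ≠ 0 →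
      0 < b j * (P ν).eval (Λ j) *
      ∑ i ∈ Finset.range (q + 1), (d i / d j) ^ n * (b i * (P ν).eval (Λ i)) := by
    rw [Filter.eventually_all_finset]
    intro ν _
    by_cases h0 : (P ν).eval (Λ j) = 0
    · simp [h0]
    · refine ((hlim ν).eventually_const_lt ?_).mono fun n hn _ => hn
      rw [Finset.sum_ite_eq' (Finset.range (q + 1)) j, if_pos (by simp; omega)]
      exact mul_self_pos.mpr (mul_ne_zero hb h0)
  obtain ⟨n, hn⟩ := hev.exists
  refine ⟨n, fun ν hν h0 => ?_⟩
  have h1 := hn ν (by simp; omega) h0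
  have h2 : E P q Λ (fun i => d i ^ n * b i) ν = d j ^ n *
      ∑ i ∈ Finset.range (q + 1), (d i / d j) ^ n * (b i * (P ν).eval (Λ i)) := by
    rw [E, Finset.mul_sum]
    refine Finset.sum_congr rfl fun i _ => ?_
    rw [div_pow]
    field_simp
  rw [h2]
  have := mul_pos (pow_pos hdj n) h1
  linarith

lemma deg_P (hP : Recurrence α β γ ρ P) (n : ℕ) : (P n).degree = n := by
  open Polynomial in
  have step : ∀ (n : ℕ) (r a b : ℝ) (R Q T : ℝ[X]), 0 < r → 0 < b → Q.degree = n →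
      R.degree < (n + 1 : ℕ) → R + C a * Q + C b * T = X * (C r * Q) → T.degree = (n + 1 : ℕ) := by
    intro n r a b R Q T hr hb hQ hR h
    have h1 : C b * T = X * (C r * Q) - (R + C a * Q) := by rw [← h]; ring
    have h2 : (X * (C r * Q)).degree = ((n + 1 : ℕ) : WithBot ℕ) := by
      rw [degree_mul, degree_C_mul hr.ne', hQ, degree_X]
      push_cast
      rw [add_comm]
    have h3 : (R + C a * Q).degree < (n + 1 : ℕ) := by
      refine (degree_add_le _ _).trans_lt (max_lt hR ?_)
      refine lt_of_le_of_lt (b := Q.degree) ?_ ?_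
      · by_cases ha : a = 0
        · simp [ha]
        · rw [degree_C_mul ha]
      · rw [hQ]; exact_mod_cast Nat.lt_succ_self n
    have h4 := congrArg degree h1
    rw [degree_C_mul hb.ne', degree_sub_eq_left_of_degree_lt (by rw [h2]; exact h3), h2] at h4
    exact h4
  have h0 : (P 0).degree = (0 : ℕ) := by simp [hP.hP0]
  suffices h : (P n).degree = n ∧ (P (n + 1)).degree = (n + 1 : ℕ) from h.1
  induction n with
  | zero =>
    refine ⟨h0, step 0 (ρ 0) (α 0) (β 0) 0 _ _ (hP.hρ 0) (hP.hβ 0) h0 (by simp) ?_⟩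
    rw [zero_add]; exact hP.hrec0
  | succ n ih =>
    refine ⟨ih.2, step (n + 1) _ _ _ _ _ _ (hP.hρ (n + 1)) (hP.hβ (n + 1)) ih.2 ?_ (hP.hrec n)⟩
    rw [Polynomial.degree_C_mul (hP.hγ n).ne', ih.1]
    exact_mod_cast (by omega : n < n + 1 + 1)

lemma exists_b (hP : Recurrence α β γ ρ P) {q : ℕ} {η : ℝ} {Λ : ℕ → ℝ}
    (hΛ : SLZeros P q η Λ) (j : ℕ) (hj : j ≤ q) :
    ∃ b : ℕ → ℝ, (∀ i, j < i → b i = 0) ∧ ∀ ν ≤ j, E P q Λ b ν = (-1) ^ ν := by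
  classical
  let M : Matrix (Fin (j + 1)) (Fin (j + 1)) ℝ := fun ν i => (P ν).eval (Λ i)
  let S : Polynomial.Sequence ℝ := ⟨P, deg_P hP⟩
  have hli : LinearIndependent ℝ P := S.linearIndependent
  have hli' : LinearIndependent ℝ (fun ν : Fin (j + 1) => P ν) :=
    hli.comp _ Fin.val_injective
  have hM : IsUnit M := by
    rw [← Matrix.vecMul_injective_iff_isUnit]
    have hz : ∀ x : Fin (j + 1) → ℝ, Matrix.vecMul x M = 0 → x = 0 := by
      intro x hx
      have hp : ∑ ν : Fin (j + 1), x ν • P ν = 0 := by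
        apply Polynomial.eq_zero_of_degree_lt_of_eval_finset_eq_zero
          ((Finset.range (j + 1)).image Λ)
        · rw [Finset.card_image_of_injOn, Finset.card_range]
          · refine (Polynomial.degree_sum_le _ _).trans_lt ?_
            rw [Finset.sup_lt_iff (by exact WithBot.bot_lt_coe _)]
            intro ν _
            refine (Polynomial.degree_smul_le _ _).trans_lt ?_
            rw [deg_P hP]
            exact_mod_cast ν.2
          · intro i hi k hk h
            simp at hi hk
            exact hΛ.anti.injOn (by simp; omega) (by simp; omega) h
        · intro y hy
          simp only [Finset.mem_image, Finset.mem_range] at hy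
          obtain ⟨i, hi, rfl⟩ := hy
          have := congrFun hx ⟨i, hi⟩
          simp only [Matrix.vecMul, dotProduct, M] at this
          simpa [Polynomial.eval_finsetSum] using this
      funext ν
      exact Fintype.linearIndependent_iff.mp hli' x hp ν
    intro x y hxy
    have := hz (x - y) (by
      rw [Matrix.sub_vecMul]
      exact sub_eq_zero.mpr hxy)
    exact sub_eq_zero.mp this
  obtain ⟨x, hx⟩ := (Matrix.mulVec_surjective_iff_isUnit.mpr hM) (fun ν => (-1) ^ (ν : ℕ))
  refine ⟨fun i => if h : i < j + 1 then x ⟨i, h⟩ else 0, fun i hi => dif_neg (by omega), ?_⟩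
  intro ν hν
  have h1 := congrFun hx ⟨ν, by omega⟩
  simp only [Matrix.mulVec, dotProduct] at h1
  rw [← h1, E, ← Finset.sum_subset (Finset.range_mono (by omega : j + 1 ≤ q + 1)),
    Finset.sum_range]
  · refine Finset.sum_congr rfl fun i _ => ?_
    rw [dif_pos i.2]
    simp [M, mul_comm]
  · intro i _ hi
    simp at hi
    rw [dif_neg (by omega), zero_mul]

lemma exists_alt (hP : Recurrence α β γ ρ P) {q : ℕ} {η : ℝ} {Λ : ℕ → ℝ}
    (hΛ : SLZeros P q η Λ) (j : ℕ) (hj : j ≤ q) :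
    ∃ b : ℕ → ℝ, (∀ i, j < i → b i = 0) ∧ b j ≠ 0 ∧ Alt q (E P q Λ b) j := by
  obtain ⟨b, hb, hE⟩ := exists_b hP hΛ j hj
  by_cases h0 : b j = 0
  · let T := ∑ ν ∈ Finset.range (q + 1), |(P ν).eval (Λ j)|
    have hT : 0 ≤ T := Finset.sum_nonneg fun _ _ => abs_nonneg _
    have hTν : ∀ ν ≤ q, |(P ν).eval (Λ j)| ≤ T := fun ν hν =>
      Finset.single_le_sum (f := fun ν => |(P ν).eval (Λ j)|) (fun _ _ => abs_nonneg _)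
        (Finset.mem_range.mpr (by omega))
    have hε : 0 < (1 + T)⁻¹ := by positivity
    refine ⟨Function.update b j (1 + T)⁻¹, fun i hi => ?_, ?_, 1, id, fun i _ => by simp,
      fun i hi => ⟨by simp; omega, ?_⟩⟩
    · rw [Function.update_of_ne (by omega)]
      exact hb i hi
    · simpa using hε.ne'
    · have e : E P q Λ (Function.update b j (1 + T)⁻¹) i =
          E P q Λ b i + (1 + T)⁻¹ * (P i).eval (Λ j) := by
        have hjm : j ∈ Finset.range (q + 1) := Finset.mem_range.mpr (by omega)
        rw [E, E, ← Finset.add_sum_erase _ _ hjm, ← Finset.add_sum_erase _ _ hjm,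
          Function.update_self, h0, Finset.sum_congr rfl (g := fun i_1 => b i_1 * _)]
        · ring
        · intro k hk
          rw [Function.update_of_ne (Finset.ne_of_mem_erase hk)]
      have hlt : |(1 + T)⁻¹ * (P i).eval (Λ j)| < 1 := by
        rw [abs_mul, abs_of_pos hε, inv_mul_lt_iff₀ (by positivity)]
        have := hTν i (by omega)
        linarith
      rw [id, e, hE i hi]
      rw [abs_lt] at hlt
      rcases neg_one_pow_eq_or ℝ i with h | h <;> rw [h] <;> linarith
  · refine ⟨b, hb, h0, 1, id, fun i _ => by simp, fun i hi => ⟨by simp; omega, ?_⟩⟩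
    rw [id, hE i hi]
    rcases neg_one_pow_eq_or ℝ i with h | h <;> rw [h] <;> norm_num

lemma alt_psi (hP : Recurrence α β γ ρ P) {q : ℕ} {η : ℝ} {Λ : ℕ → ℝ}
    (hΛ : SLZeros P q η Λ) (j : ℕ) (hj : j ≤ q) :
    Alt q (fun ν => (P ν).eval (Λ j)) j := by
  obtain ⟨b, hb, hbj, hA⟩ := exists_alt hP hΛ j hj
  obtain ⟨c, hc, hcΛ⟩ := exists_c hP q η Λ
  obtain ⟨n, hn⟩ := sign_lim (P := P) q Λ b (fun i => c - Λ i) j hj hbj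
    (fun i hi => sub_pos.mpr (hcΛ i hi)) (fun i hi hij hbi => by
      have hlt : i < j := by
        by_contra h
        exact hbi (hb i (by omega))
      have := hΛ.anti (show i ∈ Set.Iic q from hi) (show j ∈ Set.Iic q from hj) hlt
      linarith)
  exact (alt_iter hP hΛ hc hA n).of_weak hbj hn (by simp [hP.hP0])
    (psi_zero hP (root_eq hΛ j hj))

lemma alt_main (hP : Recurrence α β γ ρ P) {q : ℕ} {η : ℝ} {Λ : ℕ → ℝ}
    (hΛ : SLZeros P q η Λ) (j : ℕ) (hj : j ≤ q) (b : ℕ → ℝ) (hb : ∀ i < j, b i = 0)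
    (hbj : b j ≠ 0) : Alt q (E P q Λ b) j := by
  obtain ⟨c, hc, hcΛ⟩ := exists_c hP q η Λ
  obtain ⟨n, hn⟩ := sign_lim (P := P) q Λ b (fun i => (c - Λ i)⁻¹) j hj hbj
    (fun i hi => inv_pos.mpr (sub_pos.mpr (hcΛ i hi))) (fun i hi hij hbi => by
      have hlt : j < i := by
        by_contra h
        exact hbi (hb i (by omega))
      have := hΛ.anti (show j ∈ Set.Iic q from hj) (show i ∈ Set.Iic q from hi) hlt
      have h2 := hcΛ j hj
      exact inv_strictAnti₀ (by linarith) (by linarith))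
  have h1 := alt_iter hP hΛ hc ((alt_psi hP hΛ j hj).of_strict hn) n
  have e : E P q Λ (fun i => (c - Λ i) ^ n * ((c - Λ i)⁻¹ ^ n * b i)) = E P q Λ b := by
    funext ν
    refine Finset.sum_congr rfl fun i hi => ?_
    have : c - Λ i ≠ 0 := (sub_pos.mpr (hcΛ i (by simp at hi; omega))).ne'
    beta_reduce
    rw [← mul_assoc ((c - Λ i) ^ n), ← mul_pow, mul_inv_cancel₀ this, one_pow, one_mul]
  rwa [e] at h1

end

/-- discrete spectral gap theorem: if `m ∈ {1,…,q+1}` and the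
nontrivial function `f(ν) = Σ_{k=m}^{q+1} a_k ψ_k(ν)` has a spectral gap of length
`m`, then `m - 1 ≤ S⁻(f) ≤ N(f)`. -/
theorem stmt_11 (α β γ ρ : ℕ → ℝ) (P : ℕ → Polynomial ℝ)
    (hP : Recurrence α β γ ρ P)
    (q : ℕ) (η : ℝ) (Λ : ℕ → ℝ) (hΛ : SLZeros P q η Λ)
    (m : ℕ) (hm : 1 ≤ m) (hmq : m ≤ q + 1)
    (a : ℕ → ℝ) (ha : ∃ k ∈ Finset.Icc m (q + 1), a k ≠ 0)
    (f : ℕ → ℝ)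
    (hf : ∀ ν, f ν = ∑ k ∈ Finset.Icc m (q + 1), a k * (P ν).eval (Λ (k - 1))) :
    m - 1 ≤ Sminus q f ∧ Sminus q f ≤ N q f := by
  classical
  refine ⟨?_, Sminus_le_N q f⟩
  let b : ℕ → ℝ := fun i => if m ≤ i + 1 then a (i + 1) else 0
  have hE : f = E P q Λ b := by
    funext ν
    rw [hf ν, E]
    symm
    rw [← Finset.sum_subset (s₁ := Finset.Ico (m - 1) (q + 1))]
    · rw [show Finset.Icc m (q + 1) = Finset.Ico (m - 1 + 1) (q + 1 + 1) by
        ext x; simp; omega, ← Finset.sum_Ico_add']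
      refine Finset.sum_congr rfl fun i hi => ?_
      simp at hi
      simp only [b]
      rw [if_pos (by omega), Nat.add_sub_cancel]
    · intro x hx; simp at hx ⊢; omega
    · intro x hx hx2
      simp at hx hx2
      simp only [b]
      rw [if_neg (by omega), zero_mul]
  have hex : ∃ i, i ≤ q ∧ b i ≠ 0 := by
    obtain ⟨k, hk, hak⟩ := ha
    simp at hk
    refine ⟨k - 1, by omega, ?_⟩
    simp only [b]
    rw [if_pos (by omega), Nat.sub_add_cancel (by omega)]
    exact hak
  have hsp := Nat.find_spec hex
  have hmin : ∀ i < Nat.find hex, b i = 0 := fun i hi => by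
    by_contra h
    exact Nat.find_min hex hi ⟨by omega, h⟩
  have hmj : m - 1 ≤ Nat.find hex := by
    by_contra h
    apply hsp.2
    simp only [b]
    rw [if_neg (by omega)]
  rw [hE]
  exact ((alt_main hP hΛ _ hsp.1 b hmin hsp.2).mono hmj).le_Sminus

end DiscPaper
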